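/- Let H be a complex Hilbert space, T a bounded operator on H, and let A and C be closed densely defined operators in H, each belonging to the unbounded double commutant (T)''_ub. Suppose the subspace D := {f ∈ dom A ∩ dom C : A f = C f} is dense in H. Then the restriction A' of A to D is a closed densely defined operator, and A' belongs to (T)''_ub. -/

import Mathlib

noncomputable section

namespace SzNF

/-- A (possibly unbounded) operator `A` commutes with the bounded operator `B`:
`B` maps the domain of `A` into itself and `ABf = BAf` on the domain (expressed via
graphs). -/
def CommutesCLM {E : Type*} [NormedAddCommGroup E] [NormedSpace ℂ E]
    (B : E →L[ℂ] E) (A : E →ₗ.[ℂ] E) : Prop :=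
  ∀ f g : E, (f, g) ∈ A.graph → (B f, B g) ∈ A.graph

/-- The (possibly unbounded) operator `A` belongs to the unbounded double commutant
`(T)''_ub`: `A` commutes with every bounded operator commuting with `T`. -/
def MemUbBicommutant {E : Type*} [NormedAddCommGroup E] [NormedSpace ℂ E]
    (T : E →L[ℂ] E) (A : E →ₗ.[ℂ] E) : Prop :=
  ∀ B : E →L[ℂ] E, B ∘L T = T ∘L B → CommutesCLM B A

/-- If `A` and `C` are closed densely defined operators in a complex Hilbert space `H`,
both in the unbounded double commutant of a bounded operator `T`, and if the subspace
`D = {f ∈ dom A ∩ dom C : A f = C f}` is dense, then the restriction `A'` of `A` to `D`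
is a closed densely defined operator belonging to `(T)''_ub`. -/
theorem restriction_to_agreement_domain_closed_mem_ub_bicommutant
    {H : Type*} [NormedAddCommGroup H] [InnerProductSpace ℂ H] [CompleteSpace H]
    (T : H →L[ℂ] H) (A C : H →ₗ.[ℂ] H)
    (hAclosed : A.IsClosed) (hAdense : Dense (A.domain : Set H))
    (hAub : MemUbBicommutant T A)
    (hCclosed : C.IsClosed) (hCdense : Dense (C.domain : Set H))
    (hCub : MemUbBicommutant T C)
    (D : Submodule ℂ H)
    (hD : D = Submodule.map (LinearMap.fst ℂ H H) (A.graph ⊓ C.graph))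
    (hDdense : Dense (D : Set H)) :
    Dense ((A.domRestrict D).domain : Set H) ∧ (A.domRestrict D).IsClosed ∧
      MemUbBicommutant T (A.domRestrict D) := by
  have hg : (A.domRestrict D).graph = A.graph ⊓ C.graph := by
    ext ⟨x, y⟩
    constructor
    · intro h
      have hA : (x, y) ∈ A.graph := LinearPMap.le_graph_of_le LinearPMap.domRestrict_le h
      refine ⟨hA, ?_⟩
      have hx : x ∈ (A.domRestrict D).domain := LinearPMap.mem_domain_of_mem_graph h
      have hxD : x ∈ D := hx.1
      rw [hD] at hxD
      obtain ⟨⟨x', y'⟩, ⟨h1, h2⟩, h3⟩ := hxD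
      have h3' : x' = x := h3
      subst h3'
      have h4 : y' = y := A.mem_graph_snd_inj h1 hA rfl
      subst h4
      exact h2
    · rintro ⟨h1, h2⟩
      have hxD : x ∈ D := by
        rw [hD]
        exact ⟨(x, y), ⟨h1, h2⟩, rfl⟩
      have hxA : x ∈ A.domain := LinearPMap.mem_domain_of_mem_graph h1
      have h3 := (A.domRestrict D).mem_graph ⟨x, hxD, hxA⟩
      have h4 := A.mem_graph_snd_inj (LinearPMap.le_graph_of_le LinearPMap.domRestrict_le h3) h1 rfl
      rw [h4] at h3
      exact h3
  refine ⟨?_, ?_, ?_⟩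
  · refine hDdense.mono ?_
    intro x hx
    refine ⟨hx, ?_⟩
    have hx' : x ∈ D := hx
    rw [hD] at hx'
    obtain ⟨⟨x', y'⟩, ⟨h1, h2⟩, h3⟩ := hx'
    have h3' : x' = x := h3
    subst h3'
    exact LinearPMap.mem_domain_of_mem_graph h1
  · unfold LinearPMap.IsClosed at *
    rw [hg]
    exact hAclosed.inter hCclosed
  · intro B hB f g h
    rw [hg] at h ⊢
    exact ⟨hAub B hB f g h.1, hCub B hB f g h.2⟩

end SzNF
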